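/- Let f : (Fin n → ℂ) → (Fin m → ℂ) be a polynomial map, i.e. there is a family F : Fin m → MvPolynomial (Fin n) ℂ with (f x) i = eval x (F i) for all x and i. Let Z ⊆ (Fin m → ℂ) denote the Zariski closure of the image of f, i.e. the zero locus of the vanishing ideal of Set.range f. Then there exists a polynomial q ∈ MvPolynomial (Fin m) ℂ that does not vanish identically on Set.range f, such that every point y ∈ Z with eval y q ≠ 0 lies in Set.range f. In other words, the image of f contains a nonempty Zariski-open subset of its Zariski closure. -/

import Mathlib

/-- Chevalley-type statement: the image of a polynomial map `f : ℂⁿ → ℂᵐ`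
contains a nonempty Zariski-open subset of its Zariski closure. -/
theorem image_contains_zariski_open_of_closure {n m : ℕ}
    (F : Fin m → MvPolynomial (Fin n) ℂ) (f : (Fin n → ℂ) → (Fin m → ℂ))
    (hf : ∀ x i, f x i = MvPolynomial.eval x (F i)) :
    ∃ q : MvPolynomial (Fin m) ℂ,
      (∃ y ∈ Set.range f, MvPolynomial.eval y q ≠ 0) ∧
      ∀ y : Fin m → ℂ,
        (∀ p : MvPolynomial (Fin m) ℂ,
          (∀ z ∈ Set.range f, MvPolynomial.eval z p = 0) →
            MvPolynomial.eval y p = 0) →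
        MvPolynomial.eval y q ≠ 0 → y ∈ Set.range f := by
  classical
  let φ : MvPolynomial (Fin m) ℂ →ₐ[ℂ] MvPolynomial (Fin n) ℂ := MvPolynomial.aeval F
  have hφ : ∀ x p, MvPolynomial.eval x (φ p) = MvPolynomial.eval (f x) p := by
    intro x p
    have h : (MvPolynomial.aeval x).comp φ = MvPolynomial.aeval (R := ℂ) (f x) := by
      ext i
      simp [φ, hf, MvPolynomial.aeval_eq_eval]
    have h2 := DFunLike.congr_fun h p
    simpa [MvPolynomial.aeval_eq_eval] using h2
  have hfp : φ.toRingHom.FinitePresentation := by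
    apply RingHom.FinitePresentation.of_finiteType.mp
    apply RingHom.FiniteType.of_comp_finiteType (f := MvPolynomial.C)
    have h : φ.toRingHom.comp MvPolynomial.C = algebraMap ℂ (MvPolynomial (Fin n) ℂ) :=
      φ.comp_algebraMap
    rw [h, RingHom.finiteType_algebraMap]
    infer_instance
  obtain ⟨S, hS⟩ := PrimeSpectrum.exists_constructibleSetData_iff.mpr
    (PrimeSpectrum.isConstructible_range_comap hfp)
  have h0 : PrimeSpectrum.comap φ.toRingHom ⊥ ∈ S.toSet := hS ▸ ⟨_, rfl⟩
  simp only [PrimeSpectrum.ConstructibleSetData.toSet, Set.mem_iUnion] at h0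
  obtain ⟨D, hDS, hDg, hDf⟩ := h0
  have hg : ∀ i, φ (D.g i) = 0 := fun i => hDg ⟨i, rfl⟩
  have hq : φ D.f ≠ 0 := fun h => hDf (by
    rintro _ rfl
    exact h)
  refine ⟨D.f, ?_, ?_⟩
  · by_contra! hcon
    apply hq
    apply MvPolynomial.funext
    intro x
    rw [hφ, map_zero]
    exact hcon _ ⟨x, rfl⟩
  · intro y hy hqy
    let my : PrimeSpectrum (MvPolynomial (Fin m) ℂ) :=
      ⟨RingHom.ker (MvPolynomial.eval y), RingHom.ker_isPrime _⟩
    have hmy : my ∈ S.toSet := by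
      simp only [PrimeSpectrum.ConstructibleSetData.toSet, Set.mem_iUnion]
      refine ⟨D, hDS, ?_, ?_⟩
      · rintro _ ⟨i, rfl⟩
        apply hy
        rintro _ ⟨x, rfl⟩
        rw [← hφ, hg, map_zero]
      · intro h
        exact hqy (h rfl)
    rw [hS] at hmy
    obtain ⟨Q, hQ⟩ := hmy
    obtain ⟨M, hM, hQM⟩ := Ideal.exists_le_maximal Q.asIdeal Q.isPrime.ne_top
    obtain ⟨x, hx⟩ := MvPolynomial.eq_vanishingIdeal_singleton_of_isMaximal ℂ hM
    refine ⟨x, funext fun i => ?_⟩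
    have h1 : (MvPolynomial.X i - MvPolynomial.C (y i) : MvPolynomial (Fin m) ℂ) ∈ my.asIdeal := by
      change MvPolynomial.eval y _ = 0
      simp
    rw [← hQ] at h1
    have h2 : φ (MvPolynomial.X i - MvPolynomial.C (y i)) ∈ M := hQM h1
    rw [hx] at h2
    have h3 := h2 x rfl
    rw [MvPolynomial.aeval_eq_eval] at h3
    have h4 := (hφ _ _).symm.trans h3
    simpa [sub_eq_zero] using h4
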